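/- Let j ∈ C_c^∞(ℝ²) with supp j ⊂ B_{1/4}, ∫ j = 1, and j_ε(x) = ε⁻² j(x/ε). Then for all f ∈ H¹(ℝ²) and ε ∈ (0, 1/2], ‖j_ε * f‖_{L∞(ℝ²)} ≤ C|ln ε|^{1/2} ‖f‖_{H¹(ℝ²)} for an absolute constant C. -/

import Mathlib

open MeasureTheory

lemma ENNReal.add_sq_le_two_mul (a b : ENNReal) : (a + b) ^ 2 ≤ 2 * (a ^ 2 + b ^ 2) := by
  induction a with
  | top => simp
  | coe a =>
    induction b with
    | top => simp
    | coe b => exact_mod_cast (add_sq_le : (a + b) ^ 2 ≤ 2 * (a ^ 2 + b ^ 2))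

/-- The Cauchy–Schwarz inequality for the Lebesgue integral of `ℝ≥0∞`-valued functions. -/
lemma ENNReal.sq_lintegral_mul_le {α : Type*} [MeasurableSpace α] {μ : Measure α}
    {f g : α → ENNReal} (hf : AEMeasurable f μ) (hg : AEMeasurable g μ) :
    (∫⁻ a, f a * g a ∂μ) ^ 2 ≤ (∫⁻ a, f a ^ 2 ∂μ) * ∫⁻ a, g a ^ 2 ∂μ := by
  have h := ENNReal.lintegral_mul_le_Lp_mul_Lq μ Real.HolderConjugate.two_two hf hg
  simp only [Pi.mul_apply, ENNReal.rpow_two] at h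
  refine (pow_le_pow_left' h 2).trans_eq ?_
  rw [mul_pow, ← ENNReal.rpow_natCast, ← ENNReal.rpow_natCast, ← ENNReal.rpow_mul,
    ← ENNReal.rpow_mul]
  norm_num

lemma lintegral_comp_smul_euclideanPlane {H : EuclideanSpace ℝ (Fin 2) → ENNReal}
    (hH : Measurable H) {t : ℝ} (ht : 0 < t) :
    ∫⁻ z, H (t • z) = ENNReal.ofReal ((t ^ 2)⁻¹) * ∫⁻ z, H z := by
  rw [← lintegral_map hH (measurable_const_smul t), Measure.map_addHaar_smul _ ht.ne',
    lintegral_smul_measure, finrank_euclideanSpace_fin, abs_of_pos (by positivity), smul_eq_mul]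

lemma lintegral_Ioi_sq_mul_inv_cube_le {r : ℝ} (hr : 0 ≤ r) :
    ∫⁻ t in Set.Ioi (4 * r), ENNReal.ofReal (r ^ 2 * (t ^ 3)⁻¹) ≤ 1 := by
  rcases hr.eq_or_lt with rfl | hr
  · simp
  have h4 : 0 < 4 * r := by positivity
  have hEq : Set.EqOn (fun t : ℝ => ENNReal.ofReal (r ^ 2 * (t ^ 3)⁻¹))
      (fun t => ENNReal.ofReal (r ^ 2 * t ^ (-3 : ℝ))) (Set.Ioi (4 * r)) := by
    intro t ht
    have : 0 < t := h4.trans ht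
    simp only
    rw [Real.rpow_neg this.le]
    norm_cast
  rw [setLIntegral_congr_fun measurableSet_Ioi hEq, ← ofReal_integral_eq_lintegral_ofReal,
    integral_const_mul, integral_Ioi_rpow_of_lt (by norm_num) h4, ← ENNReal.ofReal_one]
  · apply ENNReal.ofReal_le_ofReal
    norm_num
    field_simp
    norm_num
  · exact (integrableOn_Ioi_rpow_of_lt (by norm_num) h4).const_mul _
  · filter_upwards [ae_restrict_mem measurableSet_Ioi] with t ht
    have : 0 < t := h4.trans ht
    positivity

/-- In the plane, the squared radial weight on the dilations of a ball compensates the Jacobian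
of the dilations, so the average over scales is bounded uniformly in `ε`. -/
lemma lintegral_ball_lintegral_dilation_le {G : EuclideanSpace ℝ (Fin 2) → ENNReal}
    (hG : Measurable G) {ε : ℝ} (hε : 0 < ε) (x : EuclideanSpace ℝ (Fin 2)) :
    ∫⁻ z in Metric.ball 0 (1 / 4), ∫⁻ t in Set.Ioc ε 1,
      ENNReal.ofReal (t * ‖z‖ ^ 2) * G (x - t • z) ≤ ∫⁻ z, G z := by
  obtain ⟨K, hKm, hK, hK0⟩ : ∃ K : ℝ → EuclideanSpace ℝ (Fin 2) → ENNReal,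
      Measurable (Function.uncurry K) ∧
      (∀ t y, 4 * ‖y‖ < t → K t y = ENNReal.ofReal (‖y‖ ^ 2 * t⁻¹)) ∧
      (∀ t y, ¬ 4 * ‖y‖ < t → K t y = 0) := by
    refine ⟨fun t y => {p : ℝ × EuclideanSpace ℝ (Fin 2) | 4 * ‖p.2‖ < p.1}.indicator
      (fun p => ENNReal.ofReal (‖p.2‖ ^ 2 * p.1⁻¹)) (t, y), ?_, fun t y h => ?_,
      fun t y h => ?_⟩
    · refine Measurable.indicator ?_ (measurableSet_lt ?_ ?_) <;> fun_prop
    · exact Set.indicator_of_mem (by exact h) _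
    · exact Set.indicator_of_notMem (by exact h) _
  have hscale : ∀ t ∈ Set.Ioc ε 1,
      ∫⁻ z in Metric.ball 0 (1 / 4), ENNReal.ofReal (t * ‖z‖ ^ 2) * G (x - t • z)
        = ∫⁻ y, ENNReal.ofReal ((t ^ 2)⁻¹) * (K t y * G (x - y)) := by
    intro t ht
    have ht0 : 0 < t := hε.trans ht.1
    have hm : Measurable fun y => K t y * G (x - y) :=
      hKm.of_uncurry_left.mul (hG.comp (measurable_const.sub measurable_id))
    rw [lintegral_const_mul _ hm, ← lintegral_comp_smul_euclideanPlane hm ht0,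
      ← lintegral_indicator measurableSet_ball]
    congr 1 with z
    by_cases hz : ‖z‖ < 1 / 4
    · have h1 : z ∈ Metric.ball (0 : EuclideanSpace ℝ (Fin 2)) (1 / 4) := by simpa using hz
      have h2 : 4 * ‖t • z‖ < t := by
        rw [norm_smul, Real.norm_of_nonneg ht0.le]; nlinarith
      rw [Set.indicator_of_mem h1, hK _ _ h2, norm_smul, Real.norm_of_nonneg ht0.le]
      congr 2
      field_simp
    · have h1 : z ∉ Metric.ball (0 : EuclideanSpace ℝ (Fin 2)) (1 / 4) := by simpa using hz
      have h2 : ¬ 4 * ‖t • z‖ < t := by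
        rw [norm_smul, Real.norm_of_nonneg ht0.le]; nlinarith
      rw [Set.indicator_of_notMem h1, hK0 _ _ h2, zero_mul]
  have hle : ∀ y, ∫⁻ t in Set.Ioc ε 1, ENNReal.ofReal ((t ^ 2)⁻¹) * K t y ≤ 1 := by
    intro y
    refine le_trans ?_ (lintegral_Ioi_sq_mul_inv_cube_le (norm_nonneg y))
    rw [← lintegral_indicator measurableSet_Ioc, ← lintegral_indicator measurableSet_Ioi]
    refine lintegral_mono fun t => ?_
    by_cases ht : t ∈ Set.Ioc ε 1
    · rw [Set.indicator_of_mem ht]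
      by_cases hy : 4 * ‖y‖ < t
      · rw [Set.indicator_of_mem (show t ∈ Set.Ioi (4 * ‖y‖) from hy), hK _ _ hy,
          ← ENNReal.ofReal_mul (by positivity)]
        apply le_of_eq
        congr 1
        have ht0 : 0 < t := hε.trans ht.1
        field_simp
      · simp [hK0 _ _ hy]
    · simp [Set.indicator_of_notMem ht]
  calc _ = ∫⁻ t in Set.Ioc ε 1, ∫⁻ z in Metric.ball 0 (1 / 4),
        ENNReal.ofReal (t * ‖z‖ ^ 2) * G (x - t • z) := by
        apply lintegral_lintegral_swap
        refine Measurable.aemeasurable (Measurable.mul ?_ (hG.comp ?_)) <;> fun_prop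
    _ = ∫⁻ t in Set.Ioc ε 1, ∫⁻ y, ENNReal.ofReal ((t ^ 2)⁻¹) * (K t y * G (x - y)) :=
        setLIntegral_congr_fun measurableSet_Ioc hscale
    _ = ∫⁻ y, ∫⁻ t in Set.Ioc ε 1, ENNReal.ofReal ((t ^ 2)⁻¹) * (K t y * G (x - y)) := by
        apply lintegral_lintegral_swap
        refine Measurable.aemeasurable (Measurable.mul (by fun_prop)
          (hKm.mul (hG.comp (by fun_prop))))
    _ = ∫⁻ y, (∫⁻ t in Set.Ioc ε 1, ENNReal.ofReal ((t ^ 2)⁻¹) * K t y) * G (x - y) := by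
        congr 1 with y
        rw [← lintegral_mul_const]
        · simp only [mul_assoc]
        · exact Measurable.mul (by fun_prop) hKm.of_uncurry_right
    _ ≤ ∫⁻ y, G (x - y) := lintegral_mono fun y => mul_le_of_le_one_left' (hle y)
    _ = ∫⁻ z, G z := lintegral_sub_left_eq_self _ _

lemma enorm_sub_le_lintegral_of_hasDerivAt {u u' : ℝ → ℝ} (hu : ∀ t, HasDerivAt u (u' t) t)
    {a b : ℝ} (hab : a ≤ b) : ‖u b - u a‖ₑ ≤ ∫⁻ t in Set.Ioc a b, ‖u' t‖ₑ := by
  by_cases hfin : ∫⁻ t in Set.Ioc a b, ‖u' t‖ₑ = ⊤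
  · simp [hfin]
  have hm : Measurable u' := by
    rw [show u' = deriv u from funext fun t => (hu t).deriv.symm]
    exact measurable_deriv u
  have hint : IntegrableOn u' (Set.Ioc a b) :=
    ⟨hm.aestronglyMeasurable, lt_top_iff_ne_top.2 hfin⟩
  rw [← intervalIntegral.integral_eq_sub_of_hasDerivAt (fun t _ => hu t)
    ((intervalIntegrable_iff_integrableOn_Ioc_of_le hab).2 hint),
    intervalIntegral.integral_of_le hab]
  exact enorm_integral_le_lintegral_enorm _

lemma lintegral_Ioc_inv {ε : ℝ} (hε : 0 < ε) (hε1 : ε ≤ 1) :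
    ∫⁻ t in Set.Ioc ε 1, ENNReal.ofReal t⁻¹ = ENNReal.ofReal |Real.log ε| := by
  rw [← ofReal_integral_eq_lintegral_ofReal, ← intervalIntegral.integral_of_le hε1,
    integral_inv_of_pos hε one_pos, one_div, Real.log_inv,
    abs_of_nonpos (Real.log_nonpos hε.le hε1)]
  · rw [← IntegrableOn, ← intervalIntegrable_iff_integrableOn_Ioc_of_le hε1]
    refine intervalIntegral.intervalIntegrable_inv (fun t ht => ?_) continuousOn_id
    rw [Set.uIcc_of_le hε1] at ht
    exact (hε.trans_le ht.1).ne'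
  · filter_upwards [ae_restrict_mem measurableSet_Ioc] with t ht
    exact inv_nonneg.2 (hε.trans ht.1).le

lemma enorm_sub_sq_le_log_mul_lintegral {E : Type*} [NormedAddCommGroup E] [NormedSpace ℝ E]
    [MeasurableSpace E] [BorelSpace E] [SecondCountableTopology E] {f : E → ℝ}
    (hf : Differentiable ℝ f) {ε : ℝ} (hε : 0 < ε) (hε1 : ε ≤ 1) (x z : E) :
    ‖f (x - z) - f (x - ε • z)‖ₑ ^ 2 ≤ ENNReal.ofReal |Real.log ε| *
      ∫⁻ t in Set.Ioc ε 1, ENNReal.ofReal (t * ‖z‖ ^ 2) * ‖fderiv ℝ f (x - t • z)‖ₑ ^ 2 := by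
  have hD : ∀ t : ℝ, HasDerivAt (fun t : ℝ => f (x - t • z)) (fderiv ℝ f (x - t • z) (-z)) t := by
    intro t
    have h1 : HasDerivAt (fun t : ℝ => x - t • z) (-z) t := by
      simpa using ((hasDerivAt_id t).smul_const z).const_sub x
    exact (hf _).hasFDerivAt.comp_hasDerivAt t h1
  have h := enorm_sub_le_lintegral_of_hasDerivAt hD hε1
  simp only [one_smul] at h
  have hle : ∫⁻ t in Set.Ioc ε 1, ‖fderiv ℝ f (x - t • z) (-z)‖ₑ ≤
      ∫⁻ t in Set.Ioc ε 1, ENNReal.ofReal (√t⁻¹) *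
        (ENNReal.ofReal (√t * ‖z‖) * ‖fderiv ℝ f (x - t • z)‖ₑ) := by
    refine setLIntegral_mono' measurableSet_Ioc fun t ht => ?_
    have ht0 : 0 < t := hε.trans ht.1
    rw [← mul_assoc, ← ENNReal.ofReal_mul (by positivity), ← mul_assoc,
      ← Real.sqrt_mul (by positivity), inv_mul_cancel₀ ht0.ne', Real.sqrt_one, one_mul,
      ofReal_norm, mul_comm, ← enorm_neg z]
    exact ContinuousLinearMap.le_opENorm _ _
  refine (pow_le_pow_left' (h.trans hle) 2).trans ?_
  have hm : Measurable fun t : ℝ => ‖fderiv ℝ f (x - t • z)‖ₑ :=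
    ((measurable_fderiv ℝ f).comp (by fun_prop)).enorm
  refine (ENNReal.sq_lintegral_mul_le (by fun_prop)
    (Measurable.aemeasurable (Measurable.mul (by fun_prop) hm))).trans_eq ?_
  rw [← lintegral_Ioc_inv hε hε1]
  congr 1 <;> refine setLIntegral_congr_fun measurableSet_Ioc fun t ht => ?_
  · have ht0 : 0 < t := hε.trans ht.1
    rw [← ENNReal.ofReal_pow (by positivity), Real.sq_sqrt (by positivity)]
  · have ht0 : 0 < t := hε.trans ht.1
    rw [Pi.mul_apply, mul_pow, ← ENNReal.ofReal_pow (by positivity), mul_pow,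
      Real.sq_sqrt (by positivity)]

lemma integral_rescaled_mul_eq (j f : EuclideanSpace ℝ (Fin 2) → ℝ) {ε : ℝ} (hε : 0 < ε)
    (x : EuclideanSpace ℝ (Fin 2)) :
    ∫ y, (ε ^ 2)⁻¹ * j (ε⁻¹ • (x - y)) * f y = ∫ z, j z * f (x - ε • z) := by
  have h1 := integral_sub_left_eq_self
    (fun v => (ε ^ 2)⁻¹ * (j (ε⁻¹ • v) * f (x - ε • ε⁻¹ • v))) volume x
  have h2 := Measure.integral_comp_inv_smul volume (fun z => j z * f (x - ε • z)) ε
  rw [finrank_euclideanSpace_fin, abs_of_pos (by positivity), smul_eq_mul] at h2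
  rw [integral_const_mul _ (fun v => j (ε⁻¹ • v) * f (x - ε • ε⁻¹ • v)), h2,
    inv_mul_cancel_left₀ (by positivity)] at h1
  rw [← h1]
  congr 1 with y
  rw [smul_inv_smul₀ hε.ne', sub_sub_cancel, mul_assoc]

lemma lintegral_enorm_sq_eq_ofReal {α F : Type*} [MeasurableSpace α] {μ : Measure α}
    [NormedAddCommGroup F] {g : α → F} (hg : Integrable (fun a => ‖g a‖ ^ 2) μ) :
    ∫⁻ a, ‖g a‖ₑ ^ 2 ∂μ = ENNReal.ofReal (∫ a, ‖g a‖ ^ 2 ∂μ) := by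
  rw [ofReal_integral_eq_lintegral_ofReal hg (Filter.Eventually.of_forall fun a => by positivity)]
  simp only [ENNReal.ofReal_pow (norm_nonneg _), ofReal_norm]

lemma enorm_integral_mul_sq_le {j f : EuclideanSpace ℝ (Fin 2) → ℝ} (hj : Continuous j)
    (hj_supp : Function.support j ⊆ Metric.ball 0 (1 / 4)) (hf : Differentiable ℝ f) {ε : ℝ}
    (hε : 0 < ε) (hε1 : ε ≤ 1) (x : EuclideanSpace ℝ (Fin 2)) :
    ‖∫ z, j z * f (x - ε • z)‖ₑ ^ 2 ≤ (∫⁻ z, ‖j z‖ₑ ^ 2) * (2 * ((∫⁻ z, ‖f z‖ₑ ^ 2) +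
      ENNReal.ofReal |Real.log ε| * ∫⁻ z, ‖fderiv ℝ f z‖ₑ ^ 2)) := by
  have hfc := hf.continuous
  let B := Metric.ball (0 : EuclideanSpace ℝ (Fin 2)) (1 / 4)
  have hsupp : Function.support (fun z => ‖j z * f (x - ε • z)‖ₑ) ⊆ B := by
    refine subset_trans (fun z hz => ?_) hj_supp
    contrapose! hz
    simp [Function.notMem_support.1 hz]
  have hDm : Measurable fun z => ‖fderiv ℝ f z‖ₑ ^ 2 := (measurable_fderiv ℝ f).enorm.pow_const 2
  have hsq : ∫⁻ z in B, ‖f (x - ε • z)‖ₑ ^ 2 ≤ 2 * ((∫⁻ z, ‖f z‖ₑ ^ 2) +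
      ENNReal.ofReal |Real.log ε| * ∫⁻ z, ‖fderiv ℝ f z‖ₑ ^ 2) := by
    calc _ ≤ ∫⁻ z in B, 2 * (‖f (x - z)‖ₑ ^ 2 + ‖f (x - z) - f (x - ε • z)‖ₑ ^ 2) := by
          refine lintegral_mono fun z => le_trans ?_ (ENNReal.add_sq_le_two_mul _ _)
          refine pow_le_pow_left' ?_ 2
          simpa using enorm_sub_le (a := f (x - z)) (b := f (x - z) - f (x - ε • z))
      _ = 2 * ((∫⁻ z in B, ‖f (x - z)‖ₑ ^ 2) +
            ∫⁻ z in B, ‖f (x - z) - f (x - ε • z)‖ₑ ^ 2) := by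
          rw [lintegral_const_mul' _ _ (by simp),
            lintegral_add_left (Continuous.measurable (by fun_prop))]
      _ ≤ _ := by
          refine mul_le_mul_right (add_le_add ?_ ?_) 2
          · exact (setLIntegral_le_lintegral _ _).trans_eq
              (lintegral_sub_left_eq_self (fun z => ‖f z‖ₑ ^ 2) x)
          · refine (lintegral_mono fun z =>
              enorm_sub_sq_le_log_mul_lintegral hf hε hε1 x z).trans ?_
            rw [lintegral_const_mul' _ _ ENNReal.ofReal_ne_top]
            exact mul_le_mul_right (lintegral_ball_lintegral_dilation_le hDm hε x) _
  calc _ ≤ (∫⁻ z, ‖j z * f (x - ε • z)‖ₑ) ^ 2 :=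
        pow_le_pow_left' (enorm_integral_le_lintegral_enorm _) 2
    _ = (∫⁻ z in B, ‖j z‖ₑ * ‖f (x - ε • z)‖ₑ) ^ 2 := by
        rw [← setLIntegral_eq_of_support_subset hsupp]
        simp only [enorm_mul]
    _ ≤ (∫⁻ z in B, ‖j z‖ₑ ^ 2) * ∫⁻ z in B, ‖f (x - ε • z)‖ₑ ^ 2 :=
        ENNReal.sq_lintegral_mul_le (by fun_prop) (by fun_prop)
    _ ≤ _ := mul_le_mul' (setLIntegral_le_lintegral _ _) hsq

/-- Logarithmic `L∞` bound for mollifications: for a fixed mollifier `j` with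
`supp j ⊆ B_{1/4}`, `j ≥ 0`, `∫ j = 1`, one has
`‖j_ε * f‖_{L∞} ≤ C |ln ε|^{1/2} ‖f‖_{H¹}` for all `f ∈ H¹(ℝ²)` and `ε ∈ (0,1/2]`. -/
theorem mollified_Linfty_log_bound (j : EuclideanSpace ℝ (Fin 2) → ℝ)
    (hj_smooth : ContDiff ℝ (⊤ : ℕ∞) j)
    (hj_supp : Function.support j ⊆ Metric.ball 0 (1 / 4))
    (hj_nonneg : ∀ x, 0 ≤ j x) (hj_int : (∫ x, j x) = 1) :
    ∃ C > 0, ∀ f : EuclideanSpace ℝ (Fin 2) → ℝ,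
      Differentiable ℝ f →
      Integrable (fun x => (f x) ^ 2) →
      Integrable (fun x => ‖fderiv ℝ f x‖ ^ 2) →
      ∀ ε : ℝ, 0 < ε → ε ≤ 1 / 2 →
      ∀ x, |∫ y, (ε ^ 2)⁻¹ * j (ε⁻¹ • (x - y)) * f y|
        ≤ C * Real.sqrt |Real.log ε| *
            Real.sqrt ((∫ z, (f z) ^ 2) + ∫ z, ‖fderiv ℝ f z‖ ^ 2) := by
  have hjc : Continuous j := hj_smooth.continuous
  have hjK : HasCompactSupport j := HasCompactSupport.of_support_subset_isCompact
    (isCompact_closedBall 0 (1 / 4)) (hj_supp.trans Metric.ball_subset_closedBall)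
  have hj2 : Integrable fun x => ‖j x‖ ^ 2 := by
    refine Continuous.integrable_of_hasCompactSupport (by fun_prop) ?_
    exact hjK.comp_left (g := fun r : ℝ => ‖r‖ ^ 2) (by simp)
  set J := ∫ x, ‖j x‖ ^ 2
  have hJ0 : 0 ≤ J := integral_nonneg fun x => by positivity
  refine ⟨2 * √J + 1, by positivity, fun f hf hf2 hDf2 ε hε hε2 x => ?_⟩
  set A := ∫ z, f z ^ 2
  set D := ∫ z, ‖fderiv ℝ f z‖ ^ 2
  set L := |Real.log ε| with hL
  have hA0 : 0 ≤ A := integral_nonneg fun x => by positivity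
  have hD0 : 0 ≤ D := integral_nonneg fun x => by positivity
  have hL0 : 1 / 2 ≤ L := by
    have h1 : Real.log ε ≤ Real.log (1 / 2) := Real.log_le_log hε hε2
    rw [one_div, Real.log_inv] at h1
    have := Real.log_two_gt_d9
    rw [hL, abs_of_nonpos (by linarith)]
    linarith
  have hf2' : Integrable fun z => ‖f z‖ ^ 2 := by simpa using hf2
  have htwo : ∀ r : ℝ, 2 * ENNReal.ofReal r = ENNReal.ofReal (2 * r) := fun r => by
    rw [ENNReal.ofReal_mul zero_le_two, ENNReal.ofReal_ofNat]
  have key := enorm_integral_mul_sq_le hjc hj_supp hf hε (by linarith) x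
  rw [← integral_rescaled_mul_eq j f hε x, lintegral_enorm_sq_eq_ofReal hj2,
    lintegral_enorm_sq_eq_ofReal hf2', lintegral_enorm_sq_eq_ofReal hDf2,
    ← ENNReal.ofReal_mul (abs_nonneg _), ← ENNReal.ofReal_add (by positivity) (by positivity),
    htwo, ← ENNReal.ofReal_mul hJ0,
    ← ofReal_norm, ← ENNReal.ofReal_pow (norm_nonneg _),
    ENNReal.ofReal_le_ofReal_iff (by positivity), Real.norm_eq_abs] at key
  simp only [Real.norm_eq_abs, sq_abs] at key
  have hAL : A ≤ 2 * L * A := by nlinarith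
  have hLD : 0 ≤ L * D := by positivity
  have hsq : |∫ y, (ε ^ 2)⁻¹ * j (ε⁻¹ • (x - y)) * f y| ≤ 2 * √J * √L * √(A + D) := by
    refine abs_le_of_sq_le_sq ?_ (by positivity)
    rw [mul_pow, mul_pow, mul_pow, Real.sq_sqrt hJ0, Real.sq_sqrt (abs_nonneg _),
      Real.sq_sqrt (by positivity)]
    calc _ ≤ J * (2 * (A + L * D)) := key
      _ ≤ J * (4 * L * (A + D)) := mul_le_mul_of_nonneg_left (by linarith) hJ0
      _ = _ := by ring
  refine hsq.trans ?_
  gcongr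
  linarith
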